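/- Let G be a finite simple graph with adjacency matrix A and adjacency eigenvalues λ₁, …, λₙ. Then Σⱼ sinh(λⱼ) ≥ 0, and consequently the spectral bipartivity b_s = (Σⱼ cosh(λⱼ))/(Σⱼ exp(λⱼ)) satisfies 0 < b_s ≤ 1. -/

import Mathlib

/-- The power sums of the eigenvalues of a Hermitian matrix are the traces of its powers. -/
theorem Matrix.IsHermitian.sum_eigenvalues_pow {n : Type*} [Fintype n] [DecidableEq n]
    {A : Matrix n n ℝ} (hA : A.IsHermitian) (k : ℕ) :
    ∑ j, hA.eigenvalues j ^ k = (A ^ k).trace := by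
  conv_rhs => rw [hA.spectral_theorem, ← map_pow, Unitary.conjStarAlgAut_apply,
    Matrix.trace_mul_comm, ← mul_assoc, Unitary.coe_star_mul_self, one_mul, Matrix.diagonal_pow]
  simp [Matrix.trace]

/-- The hyperbolic sine of a symmetric, entrywise nonnegative matrix has nonnegative trace. -/
theorem Matrix.IsHermitian.sum_sinh_eigenvalues_nonneg {n : Type*} [Fintype n] [DecidableEq n]
    {A : Matrix n n ℝ} (hA : A.IsHermitian) (hnonneg : ∀ i j, 0 ≤ A i j) :
    0 ≤ ∑ j, Real.sinh (hA.eigenvalues j) := by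
  refine (hasSum_sum fun j _ => Real.hasSum_sinh (hA.eigenvalues j)).nonneg fun k => ?_
  rw [← Finset.sum_div, hA.sum_eigenvalues_pow]
  exact div_nonneg (Finset.sum_nonneg fun i _ => pow_apply_nonneg hnonneg _ i i)
    (Nat.cast_nonneg _)

/-- **Bounds on the spectral bipartivity.**
Let `G` be a finite simple graph with adjacency eigenvalues `λ₁, …, λₙ`.  Then
`∑ⱼ sinh(λⱼ) ≥ 0`, and consequently the spectral bipartivity
`b_s = (∑ⱼ cosh(λⱼ))/(∑ⱼ exp(λⱼ))` satisfies `0 < b_s ≤ 1`. -/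
theorem spectral_bipartivity_bounds
    {V : Type*} [Fintype V] [DecidableEq V] [Nonempty V]
    (G : SimpleGraph V) [DecidableRel G.Adj]
    (hherm : (G.adjMatrix ℝ).IsHermitian) :
    (0 ≤ ∑ j, Real.sinh (hherm.eigenvalues j))
    ∧ 0 < (∑ j, Real.cosh (hherm.eigenvalues j)) / (∑ j, Real.exp (hherm.eigenvalues j))
    ∧ (∑ j, Real.cosh (hherm.eigenvalues j)) / (∑ j, Real.exp (hherm.eigenvalues j))
        ≤ 1 := by
  have hsinh : 0 ≤ ∑ j, Real.sinh (hherm.eigenvalues j) :=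
    hherm.sum_sinh_eigenvalues_nonneg fun i j => by
      rw [SimpleGraph.adjMatrix_apply]; positivity
  have hcosh : 0 < ∑ j, Real.cosh (hherm.eigenvalues j) :=
    Finset.sum_pos (fun j _ => Real.cosh_pos _) Finset.univ_nonempty
  have hexp : 0 < ∑ j, Real.exp (hherm.eigenvalues j) :=
    Finset.sum_pos (fun j _ => Real.exp_pos _) Finset.univ_nonempty
  refine ⟨hsinh, div_pos hcosh hexp, (div_le_one hexp).2 ?_⟩
  simp_rw [← Real.cosh_add_sinh, Finset.sum_add_distrib]
  exact le_add_of_nonneg_right hsinh
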